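/- Let T > 0 and let w be a C^∞ function on the open square Ω_T = (0,T)×(0,T). Then for every a, ν with 0 < a < ν < T, ∫_a^ν (μ+ν)^{-1} w(μ,ν)² dμ ≤ 2 w(ν,ν)² + 2ν ∫_a^ν (∂_μ w(μ,ν))² dμ (where both sides are allowed to be +∞). -/

import Mathlib

open MeasureTheory Set

/-- Cauchy–Schwarz against the constant function on an interval. -/
lemma sq_intervalIntegral_le {g : ℝ → ℝ} {x b : ℝ} (hxb : x < b)
    (hg : ContinuousOn g (Icc x b)) :
    (∫ t in x..b, g t) ^ 2 ≤ (b - x) * ∫ t in x..b, (g t) ^ 2 := by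
  have hgi : IntervalIntegrable g volume x b :=
    ContinuousOn.intervalIntegrable_of_Icc hxb.le hg
  have hg2i : IntervalIntegrable (fun t => (g t) ^ 2) volume x b :=
    ContinuousOn.intervalIntegrable_of_Icc hxb.le (hg.pow 2)
  have hL : 0 < b - x := sub_pos.2 hxb
  set I := ∫ t in x..b, g t with hI
  have hpos : 0 ≤ ∫ t in x..b, ((b - x) * g t - I) ^ 2 :=
    intervalIntegral.integral_nonneg hxb.le fun t _ => sq_nonneg _
  have hexp : ∫ t in x..b, ((b - x) * g t - I) ^ 2
      = (b - x) ^ 2 * (∫ t in x..b, (g t) ^ 2) - 2 * (b - x) * I * I + (b - x) * I ^ 2 := by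
    have : ∀ t, ((b - x) * g t - I) ^ 2
        = (b - x) ^ 2 * (g t) ^ 2 - 2 * (b - x) * I * g t + I ^ 2 := fun t => by ring
    simp_rw [this]
    rw [intervalIntegral.integral_add ((hg2i.const_mul _).sub (hgi.const_mul _)) (by simp),
      intervalIntegral.integral_sub (hg2i.const_mul _) (hgi.const_mul _),
      intervalIntegral.integral_const_mul, intervalIntegral.integral_const_mul,
      intervalIntegral.integral_const, smul_eq_mul]
  rw [hexp] at hpos
  have : 0 ≤ (b - x) * ((b - x) * (∫ t in x..b, (g t) ^ 2) - I ^ 2) := by linarith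
  linarith [nonneg_of_mul_nonneg_right this hL]

lemma sq_le_two_mul_sq_add_integral_deriv_sq {f : ℝ → ℝ} {a x b : ℝ} (hax : a ≤ x) (hxb : x < b)
    (hf : ∀ t ∈ Icc a b, DifferentiableAt ℝ f t) (hf' : ContinuousOn (deriv f) (Icc a b)) :
    (f x) ^ 2 ≤ 2 * (f b) ^ 2 + 2 * ((b - x) * ∫ t in a..b, (deriv f t) ^ 2) := by
  have hsub : Icc x b ⊆ Icc a b := Icc_subset_Icc_left hax
  have hftc : ∫ t in x..b, deriv f t = f b - f x := by
    refine intervalIntegral.integral_deriv_eq_sub (fun t ht => hf t ?_)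
      (ContinuousOn.intervalIntegrable_of_Icc hxb.le (hf'.mono hsub))
    rw [uIcc_of_le hxb.le] at ht
    exact hsub ht
  have hcs := sq_intervalIntegral_le hxb (hf'.mono hsub)
  have hmono : ∫ t in x..b, (deriv f t) ^ 2 ≤ ∫ t in a..b, (deriv f t) ^ 2 :=
    intervalIntegral.integral_mono_interval hax hxb.le le_rfl
      (Filter.Eventually.of_forall fun t => sq_nonneg _)
      (ContinuousOn.intervalIntegrable_of_Icc (hax.trans hxb.le) (hf'.pow 2))
  have := mul_le_mul_of_nonneg_left hmono (sub_pos.2 hxb).le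
  rw [hftc] at hcs
  nlinarith [sq_nonneg (f b + (f b - f x))]

/-- For `w` smooth on the open square `(0,T)×(0,T)` and `0 < a < ν < T`:
`∫_a^ν (μ+ν)^{-1} w(μ,ν)² dμ ≤ 2 w(ν,ν)² + 2ν ∫_a^ν (∂_μ w(μ,ν))² dμ`,
where all integrals are taken in `[0,∞]`. -/
theorem stmt1 (T : ℝ) (hT : 0 < T) (w : ℝ → ℝ → ℝ)
    (hw : ContDiffOn ℝ (⊤ : ℕ∞) (fun p : ℝ × ℝ => w p.1 p.2) (Ioo 0 T ×ˢ Ioo 0 T))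
    (a ν : ℝ) (ha : 0 < a) (haν : a < ν) (hν : ν < T) :
    (∫⁻ μ in Ioo a ν, ENNReal.ofReal ((μ + ν) ^ (-1 : ℝ) * (w μ ν) ^ 2))
      ≤ ENNReal.ofReal (2 * (w ν ν) ^ 2)
        + ENNReal.ofReal (2 * ν) *
          ∫⁻ μ in Ioo a ν, ENNReal.ofReal ((deriv (fun t => w t ν) μ) ^ 2) := by
  have hν0 : 0 < ν := ha.trans haν
  have hsub : Icc a ν ⊆ Ioo 0 T := fun t ht => ⟨ha.trans_le ht.1, ht.2.trans_lt hν⟩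
  have hf : ContDiffOn ℝ (⊤ : ℕ∞) (fun t => w t ν) (Ioo 0 T) :=
    hw.comp (f := fun t : ℝ => (t, ν)) (by fun_prop) fun t ht => ⟨ht, hν0, hν⟩
  set f : ℝ → ℝ := fun t => w t ν with hfdef
  have hdiff : ∀ t ∈ Icc a ν, DifferentiableAt ℝ f t := fun t ht =>
    (hf.differentiableOn (by simp)).differentiableAt (isOpen_Ioo.mem_nhds (hsub ht))
  have hcont : ContinuousOn (deriv f) (Icc a ν) :=
    (hf.continuousOn_deriv_of_isOpen isOpen_Ioo (by exact_mod_cast le_top)).mono hsub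
  set D := ∫ t in a..ν, (deriv f t) ^ 2 with hD
  have hD0 : 0 ≤ D := intervalIntegral.integral_nonneg haν.le fun t _ => sq_nonneg _
  have hDl : ∫⁻ μ in Ioo a ν, ENNReal.ofReal ((deriv f μ) ^ 2) = ENNReal.ofReal D := by
    rw [hD, intervalIntegral.integral_of_le haν.le, integral_Ioc_eq_integral_Ioo,
      ofReal_integral_eq_lintegral_ofReal]
    · exact ((hcont.pow 2).integrableOn_Icc).mono_set Ioo_subset_Icc_self
    · exact Filter.Eventually.of_forall fun t => sq_nonneg _
  rw [hDl, ← ENNReal.ofReal_mul (by positivity), ← ENNReal.ofReal_add (by positivity)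
    (by positivity)]
  have hpt : ∀ μ ∈ Ioo a ν, (μ + ν) ^ (-1 : ℝ) * (w μ ν) ^ 2
      ≤ (2 * (w ν ν) ^ 2 + 2 * ν * D) / ν := by
    intro μ hμ
    have hμ0 : 0 < μ := ha.trans hμ.1
    have h := sq_le_two_mul_sq_add_integral_deriv_sq hμ.1.le hμ.2 hdiff hcont
    have h' : (w μ ν) ^ 2 ≤ 2 * (w ν ν) ^ 2 + 2 * ν * D := by
      have : 0 ≤ μ * D := by positivity
      simp only [hfdef] at h
      linarith
    rw [Real.rpow_neg_one, inv_mul_eq_div]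
    exact div_le_div₀ (by positivity) h' hν0 (by linarith)
  calc _ ≤ ∫⁻ _ in Ioo a ν, ENNReal.ofReal ((2 * (w ν ν) ^ 2 + 2 * ν * D) / ν) :=
        setLIntegral_mono measurable_const fun μ hμ => ENNReal.ofReal_le_ofReal (hpt μ hμ)
    _ = ENNReal.ofReal ((2 * (w ν ν) ^ 2 + 2 * ν * D) / ν * (ν - a)) := by
        rw [setLIntegral_const, Real.volume_Ioo, ← ENNReal.ofReal_mul (by positivity)]
    _ ≤ _ := by
        refine ENNReal.ofReal_le_ofReal ?_
        rw [div_mul_eq_mul_div, div_le_iff₀ hν0]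
        exact mul_le_mul_of_nonneg_left (by linarith) (by positivity)
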